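/- Let n ≥ 2 and let K ⊆ {1,…,n} be a set of k positions with 1 ≤ k ≤ n, and let (F_m)_{m∈ℕ} be a k-entry social choice rule for n candidates. Then the rule has distortion at least (2n−k)/k: for every real c < (2n−k)/k there exist a number of voters m ≥ 1, a profile Π = (π_v)_{v∈Fin m} of rankings, and a distance function d for m voters consistent with Π, such that Σ_v d(v, F_m(Π)) ≥ c · min_{y candidate} Σ_v d(v, y). -/

import Mathlib

/-- Voters in `M` are at distance `1` from every candidate; all the others share a location with the
candidates outside `B`, at distance `2` from those in `B`. -/
theorem exists_two_location_distance {n m : ℕ} (hm : 1 ≤ m) (P : Fin m → (Fin n ≃ Fin n))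
    (M : Finset (Fin m)) (B : Finset (Fin n)) {w y : Fin n} (hw : w ∈ B) (hy : y ∉ B)
    (hB : ∀ v, v ∉ M → ∀ i j, i ≤ j → P v i ∈ B → P v j ∈ B)
    {c : ℝ} (hc : c * M.card ≤ 2 * m - M.card) :
    ∃ d : Fin m → Fin n → ℝ,
      (∀ v x, 0 ≤ d v x) ∧
      (∀ v v' x y, d v y ≤ d v x + d v' x + d v' y) ∧
      (∀ (v : Fin m) (i j : Fin n), i ≤ j → d v (P v i) ≤ d v (P v j)) ∧
      c * ∑ v, d v y ≤ ∑ v, d v w ∧ 0 < ∑ v, d v w := by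
  have hy_sum : ∑ v : Fin m, (if v ∈ M then (1 : ℝ) else if y ∈ B then 2 else 0) = M.card := by
    simp [hy]
  have hw_sum : ∑ v : Fin m, (if v ∈ M then (1 : ℝ) else if w ∈ B then 2 else 0)
      = 2 * m - M.card := by
    have h : ∀ v : Fin m, (if v ∈ M then (1 : ℝ) else if w ∈ B then 2 else 0)
        = 2 - (if v ∈ M then 1 else 0) := by
      intro v
      split_ifs <;> norm_num
    simp only [h, Finset.sum_sub_distrib]
    simp [mul_comm]
  refine ⟨fun v x => if v ∈ M then 1 else if x ∈ B then 2 else 0, ?_, ?_, ?_, ?_, ?_⟩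
  · intro v x
    dsimp only
    split_ifs <;> norm_num
  · intro v v' x y
    dsimp only
    split_ifs <;> norm_num
  · intro v i j hij
    have := hB v
    dsimp only
    split_ifs with h1 h2 h3 h3
    · norm_num
    · norm_num
    · exact absurd (this h1 i j hij h2) h3
    · norm_num
    · norm_num
  · dsimp only
    rw [hy_sum, hw_sum]
    exact hc
  · dsimp only
    rw [hw_sum]
    have h1 : (M.card : ℝ) ≤ m := by exact_mod_cast (Finset.card_le_univ M).trans (by simp)
    have h2 : (1 : ℝ) ≤ m := by exact_mod_cast hm
    linarith

/-- A cyclic profile on the candidates up to `q`, the later candidates staying fixed. -/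
theorem exists_cyclic_profile {n : ℕ} (q : Fin n) :
    ∃ π : Fin (q.val + 1) → (Fin n ≃ Fin n),
      (∀ v i, q < i → π v i = i) ∧
      ∀ w ≤ q, Function.Injective fun v => (π v).symm w := by
  let e : Fin (q.val + 1) ≃ {x : Fin n // x ≤ q} :=
    { toFun := fun a => ⟨⟨a.val, by omega⟩, by rw [Fin.le_def]; simp; omega⟩
      invFun := fun x => ⟨x.1.val, by have := x.2; rw [Fin.le_def] at this; omega⟩
      left_inv := fun a => rfl
      right_inv := fun x => rfl }
  refine ⟨fun v => (Equiv.addRight v : Equiv.Perm (Fin (q.val + 1))).extendDomain e, ?_, ?_⟩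
  · intro v i hi
    exact Equiv.Perm.extendDomain_apply_not_subtype _ _ (not_le.2 hi)
  · intro w hw v v' h
    dsimp only at h
    obtain ⟨a, rfl⟩ : ∃ a, w = e a := ⟨e.symm ⟨w, hw⟩, by simp⟩
    change ((Equiv.Perm.extendDomain (Equiv.addRight v) e)⁻¹ : Equiv.Perm _) _
      = ((Equiv.Perm.extendDomain (Equiv.addRight v') e)⁻¹ : Equiv.Perm _) _ at h
    rw [Equiv.Perm.extendDomain_inv, Equiv.Perm.extendDomain_inv,
      Equiv.Perm.extendDomain_apply_image, Equiv.Perm.extendDomain_apply_image] at h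
    have h' := e.injective (Subtype.ext h)
    change a + -v = a + -v' at h'
    simpa using h'

/-- The lower bound in nondegenerate form: the chosen candidate has positive cost. -/
theorem exists_costly_choice (n k : ℕ) (hn : 2 ≤ n) (hk1 : 1 ≤ k) (hkn : k ≤ n)
    (K : Finset (Fin n)) (hK : K.card = k)
    (F : ∀ m : ℕ, (Fin m → (Fin n ≃ Fin n)) → Fin n)
    (hF : ∀ (m : ℕ) (P P' : Fin m → (Fin n ≃ Fin n)),
      (∀ v : Fin m, ∀ i ∈ K, P v i = P' v i) → F m P = F m P')
    (c : ℝ) (hc : c ≤ (2 * (n : ℝ) - k) / k) :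
    ∃ (m : ℕ), 1 ≤ m ∧ ∃ (P : Fin m → (Fin n ≃ Fin n)) (y : Fin n) (d : Fin m → Fin n → ℝ),
      (∀ v x, 0 ≤ d v x) ∧
      (∀ v v' x y, d v y ≤ d v x + d v' x + d v' y) ∧
      (∀ (v : Fin m) (i j : Fin n), i ≤ j → d v (P v i) ≤ d v (P v j)) ∧
      c * ∑ v, d v y ≤ ∑ v, d v (F m P) ∧ 0 < ∑ v, d v (F m P) := by
  have hk0 : (0 : ℝ) < k := by exact_mod_cast hk1
  have hkn' : (k : ℝ) ≤ n := by exact_mod_cast hkn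
  rw [le_div_iff₀ hk0] at hc
  let z : Fin n := ⟨0, by omega⟩
  let o : Fin n := ⟨1, by omega⟩
  have hzo : z ≠ o := by simp [z, o]
  by_cases hex : ((Finset.univ \ K).filter fun i => z < i).Nonempty
  · obtain ⟨q, hq, hmax⟩ := Finset.exists_max_image _ id hex
    simp only [Finset.mem_filter, Finset.mem_sdiff, Finset.mem_univ, true_and] at hq
    obtain ⟨hqK, hzq⟩ := hq
    have hafter : ∀ i, q < i → i ∈ K := by
      intro i hi
      by_contra hiK
      exact absurd (hmax i (by simp [hiK, hzq.trans hi])) (not_le.2 hi)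
    obtain ⟨π, hfix, hinj⟩ := exists_cyclic_profile q
    have hlater : ∀ v i, q < π v i ↔ q < i := by
      intro v i
      refine ⟨fun h => ?_, fun h => (hfix v i h).symm ▸ h⟩
      have := (π v).injective (hfix v _ h)
      rwa [this] at h
    rcases lt_or_ge q (F _ π) with hw | hw
    · refine ⟨q.val + 1, by omega, π, q, ?_⟩
      refine exists_two_location_distance (by omega) π ∅ (Finset.Ioi q) (by simpa using hw)
        (by simp) ?_ ?_
      · intro v _ i j hij hi
        simp only [Finset.mem_Ioi, hlater] at hi ⊢
        exact hi.trans_le hij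
      · simp only [Finset.card_empty, Nat.cast_zero]
        simp only [mul_zero, sub_zero]
        positivity
    · obtain ⟨w, hwdef⟩ : ∃ w, w = F _ π := ⟨_, rfl⟩
      rw [← hwdef] at hw
      let M : Finset (Fin (q.val + 1)) := Finset.univ.filter fun v => (π v).symm w ∈ K
      let P : Fin (q.val + 1) → (Fin n ≃ Fin n) := fun v =>
        if v ∈ M then π v else (Equiv.swap ((π v).symm w) q).trans (π v)
      have hPF : F _ P = w := by
        rw [hwdef]
        refine hF _ _ _ fun v i hi => ?_
        by_cases hv : v ∈ M
        · simp [P, hv]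
        · have hiw : i ≠ (π v).symm w := by
            rintro rfl
            exact hv (by simpa [M] using hi)
          have hiq : i ≠ q := by
            rintro rfl
            exact hqK hi
          simp [P, hv, Equiv.swap_apply_of_ne_of_ne hiw hiq]
      obtain ⟨y, hyq, hyw⟩ : ∃ y, y ≤ q ∧ y ≠ w := by
        by_cases h : w = q
        · exact ⟨z, hzq.le, h ▸ hzq.ne⟩
        · exact ⟨q, le_rfl, Ne.symm h⟩
      have hcard : M.card + (n - 1 - q) ≤ k := by
        have h1 : M.card ≤ (K.filter fun i => ¬ q < i).card := by
          refine Finset.card_le_card_of_injOn (fun v => (π v).symm w) ?_ (hinj w hw).injOn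
          intro v hv
          have hv' : (π v).symm w ∈ K := by simpa [M] using hv
          have h2 := hlater v ((π v).symm w)
          rw [Equiv.apply_symm_apply] at h2
          simp only [Finset.coe_filter, Set.mem_ofPred_eq]
          exact ⟨hv', fun h => absurd (h2.2 h) (not_lt.2 hw)⟩
        have h2 : (K.filter fun i => q < i) = Finset.Ioi q := by
          ext i
          simpa using hafter i
        have h3 := Finset.card_filter_add_card_filter_not (s := K) (fun i => q < i)
        rw [h2, Fin.card_Ioi, hK] at h3
        omega
      refine ⟨q.val + 1, by omega, P, y, ?_⟩
      rw [hPF]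
      refine exists_two_location_distance (by omega) P M (insert w (Finset.Ioi q)) (by simp)
        (by simp [hyq, hyw]) ?_ ?_
      · intro v hv
        have key : ∀ i, P v i ∈ insert w (Finset.Ioi q) ↔ q ≤ i := by
          intro i
          have hsymm : (π v).symm w ≤ q := by
            have h2 := hlater v ((π v).symm w)
            rw [Equiv.apply_symm_apply] at h2
            exact not_lt.1 fun h => absurd (h2.2 h) (not_lt.2 hw)
          have hPv : P v i = π v (Equiv.swap ((π v).symm w) q i) := by simp [P, hv]
          rw [hPv, Finset.mem_insert, Finset.mem_Ioi, hlater, ← Equiv.eq_symm_apply,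
            Equiv.swap_apply_def]
          split_ifs <;> grind
        intro i j hij hi
        rw [key] at hi ⊢
        exact hi.trans hij
      · have hq' : q.val < n := q.2
        have h1 : M.card + n ≤ k + (q.val + 1) := by omega
        have h2 : (M.card : ℝ) + n ≤ k + ((q.val + 1 : ℕ) : ℝ) := by exact_mod_cast h1
        have h4 : ((q.val + 1 : ℕ) : ℝ) ≤ n := by exact_mod_cast hq'
        generalize ((q.val + 1 : ℕ) : ℝ) = t at h2 h4 ⊢
        suffices h : ((c + 1) * M.card) * k ≤ (2 * t) * k by
          have := le_of_mul_le_mul_right h hk0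
          linarith
        have h5 : ((c + 1) * k) * M.card ≤ 2 * n * M.card := by
          refine mul_le_mul_of_nonneg_right ?_ (Nat.cast_nonneg _)
          linarith
        have h6 : (n : ℝ) * M.card ≤ n * (k + t - n) := by
          refine mul_le_mul_of_nonneg_left ?_ (Nat.cast_nonneg _)
          linarith
        nlinarith [mul_nonneg (sub_nonneg.2 hkn') (sub_nonneg.2 h4)]
  · have hlate : Finset.Ioi z ⊆ K := by
      intro i hi
      by_contra hiK
      exact hex ⟨i, by simpa [hiK] using hi⟩
    have hcard := Finset.card_le_card hlate
    rw [Fin.card_Ioi, hK] at hcard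
    have hn2k : n ≤ 2 * k := by
      simp only [z] at hcard
      omega
    have hn2k' : (n : ℝ) ≤ 2 * k := by exact_mod_cast hn2k
    have hc3 : c ≤ 3 := by
      refine le_of_mul_le_mul_right ?_ hk0
      linarith
    have hz : ∀ i : Fin n, z ≤ i := fun i => by simp [Fin.le_def, z]
    let P : Fin 2 → (Fin n ≃ Fin n) := ![Equiv.refl _, Equiv.swap z o]
    by_cases hw : F 2 P = z
    · refine ⟨2, by omega, P, o, ?_⟩
      refine exists_two_location_distance (by omega) P {0} {o}ᶜ (by simp [hw, hzo]) (by simp) ?_ ?_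
      · intro v hv i j hij hi
        obtain rfl : v = 1 := by
          simp only [Finset.mem_singleton] at hv
          omega
        have hPo : ∀ i, P 1 i = o ↔ i = z := by
          intro i
          simp [P, ← Equiv.eq_symm_apply]
        simp only [Finset.mem_compl, Finset.mem_singleton, hPo] at hi ⊢
        rintro rfl
        exact hi (le_antisymm hij (hz i))
      · norm_num
        linarith
    · refine ⟨2, by omega, P, z, ?_⟩
      refine exists_two_location_distance (by omega) P {1} {z}ᶜ (by simp [hw]) (by simp) ?_ ?_
      · intro v hv i j hij hi
        obtain rfl : v = 0 := by
          simp only [Finset.mem_singleton] at hv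
          omega
        simp only [Finset.mem_compl, Finset.mem_singleton, P, Matrix.cons_val_zero,
          Equiv.refl_apply] at hi ⊢
        rintro rfl
        exact hi (le_antisymm hij (hz i))
      · norm_num
        linarith

/-- Every deterministic one-round `k`-entry social choice rule
(voters can only communicate the candidates in positions `K` of their ranking)
has distortion at least `(2n - k)/k`. Rankings are bijections from positions
`Fin n` (position `0` most preferred) to candidates `Fin n`. -/
theorem k_entry_lower_bound (n k : ℕ) (hn : 2 ≤ n) (hk1 : 1 ≤ k) (hkn : k ≤ n)
    (K : Finset (Fin n)) (hK : K.card = k)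
    (F : ∀ m : ℕ, (Fin m → (Fin n ≃ Fin n)) → Fin n)
    (hF : ∀ (m : ℕ) (P P' : Fin m → (Fin n ≃ Fin n)),
      (∀ v : Fin m, ∀ i ∈ K, P v i = P' v i) → F m P = F m P')
    (c : ℝ) (hc : c < (2 * (n : ℝ) - k) / k) :
    ∃ (m : ℕ), 1 ≤ m ∧ ∃ (P : Fin m → (Fin n ≃ Fin n)) (d : Fin m → Fin n → ℝ),
      (∀ v x, 0 ≤ d v x) ∧
      (∀ v v' x y, d v y ≤ d v x + d v' x + d v' y) ∧
      (∀ (v : Fin m) (i j : Fin n), i ≤ j → d v (P v i) ≤ d v (P v j)) ∧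
      c * (Finset.univ.inf' ⟨(⟨0, by omega⟩ : Fin n), Finset.mem_univ _⟩
            (fun y : Fin n => ∑ v, d v y)) ≤ ∑ v, d v (F m P) := by
  have hk0 : (0 : ℝ) < k := by exact_mod_cast hk1
  have hkn' : (k : ℝ) ≤ n := by exact_mod_cast hkn
  have hc' : max c 0 ≤ (2 * (n : ℝ) - k) / k :=
    max_le hc.le (div_nonneg (by linarith) hk0.le)
  obtain ⟨m, hm, P, y, d, hd, htri, hcons, hcost, -⟩ :=
    exists_costly_choice n k hn hk1 hkn K hK F hF (max c 0) hc'
  refine ⟨m, hm, P, d, hd, htri, hcons, le_trans ?_ hcost⟩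
  have hmin : 0 ≤ Finset.univ.inf' ⟨(⟨0, by omega⟩ : Fin n), Finset.mem_univ _⟩
      (fun y : Fin n => ∑ v, d v y) :=
    Finset.le_inf' _ _ fun x _ => Finset.sum_nonneg fun v _ => hd v x
  exact (mul_le_mul_of_nonneg_right (le_max_left c 0) hmin).trans
    (mul_le_mul_of_nonneg_left (Finset.inf'_le _ (Finset.mem_univ y)) (le_max_right _ _))
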